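/- Let {i, j, k} = {1, 2, 3}, μ ∈ {1, −1}, 𝔥 = k·a_i ⊕ k·(a_j + μ a_k), and let φ ∈ 𝔥* satisfy φ(a_i) = μ/2 (so that φ determines a 1-dimensional 𝔥-module k_φ). Then the homogenization ℋ(U(g) ⊗_{U(𝔥)} k_φ) is a line module over H on which a₄ acts without torsion, and ℋ(U(g) ⊗_{U(𝔥)} k_φ) ≅ H/(H(a₄ − 2μ a_i) + H(a_j + μ a_k − φ(a_j + μ a_k)a₄)) as graded left H-modules; moreover distinct pairs (𝔥, φ) of this form yield non-isomorphic line modules, so the assignment (𝔥, φ) ↦ ℋ(U(g) ⊗_{U(𝔥)} k_φ) is one-to-one. -/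

import Mathlib

noncomputable section
open scoped DirectSum

/-- Relations of `U(sl₂ᶜ(k)) = k⟨a₁,a₂,a₃⟩/⟨a₁a₂+a₂a₁−a₃, a₂a₃+a₃a₂−a₁, a₃a₁+a₁a₃−a₂⟩`
(generators `0 = a₁, 1 = a₂, 2 = a₃`). -/
inductive UcolRel (k : Type) [Field k] :
    FreeAlgebra k (Fin 3) → FreeAlgebra k (Fin 3) → Prop
  | r12 : UcolRel k
      (FreeAlgebra.ι k 0 * FreeAlgebra.ι k 1 + FreeAlgebra.ι k 1 * FreeAlgebra.ι k 0)
      (FreeAlgebra.ι k 2)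
  | r23 : UcolRel k
      (FreeAlgebra.ι k 1 * FreeAlgebra.ι k 2 + FreeAlgebra.ι k 2 * FreeAlgebra.ι k 1)
      (FreeAlgebra.ι k 0)
  | r31 : UcolRel k
      (FreeAlgebra.ι k 2 * FreeAlgebra.ι k 0 + FreeAlgebra.ι k 0 * FreeAlgebra.ι k 2)
      (FreeAlgebra.ι k 1)

/-- `U(g)` for the color Lie algebra `g = sl₂ᶜ(k)`. -/
abbrev Ucol (k : Type) [Field k] := RingQuot (UcolRel k)

/-- The images of the generators `a₁, a₂, a₃` in `U(g)`. -/
def genC (k : Type) [Field k] (i : Fin 3) : Ucol k :=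
  RingQuot.mkAlgHom k (UcolRel k) (FreeAlgebra.ι k i)

/-- Relations of the homogenization `H` of `U(sl₂ᶜ(k))` by a central element `a₄`
(generators `0 = a₁, 1 = a₂, 2 = a₃, 3 = a₄`). -/
inductive HcolRel (k : Type) [Field k] :
    FreeAlgebra k (Fin 4) → FreeAlgebra k (Fin 4) → Prop
  | r12 : HcolRel k
      (FreeAlgebra.ι k 0 * FreeAlgebra.ι k 1 + FreeAlgebra.ι k 1 * FreeAlgebra.ι k 0)
      (FreeAlgebra.ι k 2 * FreeAlgebra.ι k 3)
  | r23 : HcolRel k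
      (FreeAlgebra.ι k 1 * FreeAlgebra.ι k 2 + FreeAlgebra.ι k 2 * FreeAlgebra.ι k 1)
      (FreeAlgebra.ι k 0 * FreeAlgebra.ι k 3)
  | r31 : HcolRel k
      (FreeAlgebra.ι k 2 * FreeAlgebra.ι k 0 + FreeAlgebra.ι k 0 * FreeAlgebra.ι k 2)
      (FreeAlgebra.ι k 1 * FreeAlgebra.ι k 3)
  | c1 : HcolRel k (FreeAlgebra.ι k 0 * FreeAlgebra.ι k 3) (FreeAlgebra.ι k 3 * FreeAlgebra.ι k 0)
  | c2 : HcolRel k (FreeAlgebra.ι k 1 * FreeAlgebra.ι k 3) (FreeAlgebra.ι k 3 * FreeAlgebra.ι k 1)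
  | c3 : HcolRel k (FreeAlgebra.ι k 2 * FreeAlgebra.ι k 3) (FreeAlgebra.ι k 3 * FreeAlgebra.ι k 2)

/-- The homogenization `H` of `U(sl₂ᶜ(k))` by the central element `a₄`. -/
abbrev Hcol (k : Type) [Field k] := RingQuot (HcolRel k)

/-- The images of the generators `a₁, a₂, a₃, a₄` in `H`. -/
def genHC (k : Type) [Field k] (i : Fin 4) : Hcol k :=
  RingQuot.mkAlgHom k (HcolRel k) (FreeAlgebra.ι k i)

/-- `M` is a line module over `A`: a cyclic graded module, generated in degree 0,
whose degree-`n` component has `k`-dimension `n+1`, where the (images of the) degree-one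
generators of `A` are the set `gens`. -/
def IsLineModule (k A M : Type) [Field k] [Ring A] [Algebra k A]
    [AddCommGroup M] [Module k M] [Module A M] [IsScalarTower k A M]
    (gens : Set A) : Prop :=
  ∃ gr : ℕ → Submodule k M,
    iSupIndep gr ∧ (⨆ n, gr n) = ⊤ ∧
    (∀ n, Module.finrank k (gr n) = n + 1) ∧
    (∀ a ∈ gens, ∀ n, ∀ m ∈ gr n, a • m ∈ gr (n + 1)) ∧
    (∃ m₀ ∈ gr 0, Submodule.span A {m₀} = ⊤)

/-- The filtration of `U(g)`: `CF n` is the span of products of at most `n` generators. -/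
def CF (k : Type) [Field k] (n : ℕ) : Submodule k (Ucol k) :=
  (Submodule.span k ({1} ∪ Set.range (genC k))) ^ n

/-- The left ideal `U(g)u₁ + U(g)u₂` of `U(g)`. -/
def JUc (k : Type) [Field k] (u₁ u₂ : Ucol k) : Submodule (Ucol k) (Ucol k) :=
  Submodule.span (Ucol k) {u₁, u₂}

/-- The induced module `M = U(g) ⊗_{U(𝔥)} k_φ`, realized via its standard presentation as
the cyclic module `U(g)/(U(g)(x − φ(x)) + U(g)(y − φ(y)))` for spanning vectors `x, y` of
`𝔥` (here `u₁ = x − φ(x)`, `u₂ = y − φ(y)`). -/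
abbrev NmodC (k : Type) [Field k] (u₁ u₂ : Ucol k) := Ucol k ⧸ JUc k u₁ u₂

/-- The induced filtration `M_i` = image of `U(g)_i` in `M`. -/
def NFC (k : Type) [Field k] (u₁ u₂ : Ucol k) (i : ℕ) : Submodule k (NmodC k u₁ u₂) :=
  Submodule.map (((JUc k u₁ u₂).mkQ).restrictScalars k) (CF k i)

/-- The left ideal `Hw₁ + Hw₂` of `H`. -/
def JHc (k : Type) [Field k] (w₁ w₂ : Hcol k) : Submodule (Hcol k) (Hcol k) :=
  Submodule.span (Hcol k) {w₁, w₂}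

/-- The cyclic graded `H`-module `H/(Hw₁ + Hw₂)`. -/
abbrev LmodC (k : Type) [Field k] (w₁ w₂ : Hcol k) := Hcol k ⧸ JHc k w₁ w₂

/-- `Φ` is an isomorphism of graded left `H`-modules from `H/(Hw₁ + Hw₂)` onto the
homogenization `ℋ(M) = ⊕_{i≥0} M_i a₄^i` of `M = U(g)/(U(g)u₁ + U(g)u₂)` (identifying
`M_i a₄^i` with `M_i`, so that `ℋ(M)` is `⨁ i, M_i` with `a₄` acting by the shift
`m a₄^i ↦ m a₄^{i+1}` and `x ∈ {a₁,a₂,a₃}` acting by `m a₄^i ↦ (xm) a₄^{i+1}`):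
`Φ` is a `k`-linear isomorphism matching the canonical cyclic generators and intertwining
the actions of the generators `a₁, a₂, a₃, a₄` of `H`. -/
def IsHomogenizationIsoC (k : Type) [Field k] (u₁ u₂ : Ucol k) (w₁ w₂ : Hcol k)
    (Φ : LmodC k w₁ w₂ ≃ₗ[k] ⨁ i : ℕ, ↥(NFC k u₁ u₂ i)) : Prop :=
  ((Φ (Submodule.Quotient.mk 1) 0 : NmodC k u₁ u₂) = Submodule.Quotient.mk 1 ∧
    ∀ i : ℕ, Φ (Submodule.Quotient.mk 1) (i + 1) = 0) ∧
  (∀ x : LmodC k w₁ w₂,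
    Φ (genHC k 3 • x) 0 = 0 ∧
    ∀ i : ℕ, (Φ (genHC k 3 • x) (i + 1) : NmodC k u₁ u₂) = (Φ x i : NmodC k u₁ u₂)) ∧
  (∀ j : Fin 3, ∀ x : LmodC k w₁ w₂,
    Φ (genHC k j.castSucc • x) 0 = 0 ∧
    ∀ i : ℕ, (Φ (genHC k j.castSucc • x) (i + 1) : NmodC k u₁ u₂) =
      genC k j • (Φ x i : NmodC k u₁ u₂))

section Helpers

variable {k : Type} [Field k]

/-! ### Relations -/

lemma genC_rel (i j l : Fin 3) (hij : i ≠ j) (hjl : j ≠ l) (hil : i ≠ l) :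
    genC k i * genC k j + genC k j * genC k i = genC k l := by
  have h1 := RingQuot.mkAlgHom_rel k (UcolRel.r12 (k := k))
  have h2 := RingQuot.mkAlgHom_rel k (UcolRel.r23 (k := k))
  have h3 := RingQuot.mkAlgHom_rel k (UcolRel.r31 (k := k))
  simp only [map_add, map_mul] at h1 h2 h3
  fin_cases i <;> fin_cases j <;> fin_cases l <;> simp_all [genC] <;>
    first
    | exact h1 | exact h2 | exact h3
    | (rw [add_comm]; first | exact h1 | exact h2 | exact h3)

lemma genHC_rel (i j l : Fin 3) (hij : i ≠ j) (hjl : j ≠ l) (hil : i ≠ l) :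
    genHC k i.castSucc * genHC k j.castSucc + genHC k j.castSucc * genHC k i.castSucc
      = genHC k l.castSucc * genHC k 3 := by
  have h1 := RingQuot.mkAlgHom_rel k (HcolRel.r12 (k := k))
  have h2 := RingQuot.mkAlgHom_rel k (HcolRel.r23 (k := k))
  have h3 := RingQuot.mkAlgHom_rel k (HcolRel.r31 (k := k))
  simp only [map_add, map_mul] at h1 h2 h3
  fin_cases i <;> fin_cases j <;> fin_cases l <;> simp_all [genHC] <;>
    first
    | exact h1 | exact h2 | exact h3
    | (rw [add_comm]; first | exact h1 | exact h2 | exact h3)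

lemma genHC_comm (m : Fin 4) : genHC k m * genHC k 3 = genHC k 3 * genHC k m := by
  have h1 := RingQuot.mkAlgHom_rel k (HcolRel.c1 (k := k))
  have h2 := RingQuot.mkAlgHom_rel k (HcolRel.c2 (k := k))
  have h3 := RingQuot.mkAlgHom_rel k (HcolRel.c3 (k := k))
  simp only [map_mul] at h1 h2 h3
  fin_cases m
  · exact h1
  · exact h2
  · exact h3
  · rfl

/-- Induction principle for `H`. -/
lemma Hcol_induction {P : Hcol k → Prop} (hc : ∀ c : k, P (algebraMap k _ c))
    (hg : ∀ m, P (genHC k m)) (hm : ∀ a b, P a → P b → P (a * b))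
    (ha : ∀ a b, P a → P b → P (a + b)) (h : Hcol k) : P h := by
  obtain ⟨x, rfl⟩ := RingQuot.mkAlgHom_surjective k (HcolRel k) h
  induction x using FreeAlgebra.induction with
  | grade0 r => rw [AlgHom.commutes]; exact hc r
  | grade1 x => exact hg x
  | mul a b h1 h2 => rw [map_mul]; exact hm _ _ h1 h2
  | add a b h1 h2 => rw [map_add]; exact ha _ _ h1 h2

/-! ### The polynomial model of the induced module -/

open Polynomial in
/-- Values of the operators `a_i, a_j` on `X ^ n`. -/
def ABseq (μ β : k) : ℕ → k[X] × k[X]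
  | 0 => (C (μ / 2), C (-μ) * X + C β)
  | n + 1 => ((ABseq μ β n).2 - X * (ABseq μ β n).1, (ABseq μ β n).1 - X * (ABseq μ β n).2)

open Polynomial in
/-- The operator of `a_i`. -/
def opA (μ β : k) : Module.End k k[X] :=
  (Polynomial.basisMonomials k).constr k fun n => (ABseq μ β n).1

open Polynomial in
/-- The operator of `a_j`. -/
def opB (μ β : k) : Module.End k k[X] :=
  (Polynomial.basisMonomials k).constr k fun n => (ABseq μ β n).2

open Polynomial in
/-- The operator of `a_l`. -/
def opX : Module.End k k[X] := LinearMap.mulLeft k X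

open Polynomial in
lemma opA_pow (μ β : k) (n : ℕ) : opA μ β (X ^ n) = (ABseq μ β n).1 := by
  have h := (Polynomial.basisMonomials k).constr_basis k (fun n => (ABseq μ β n).1) n
  rwa [show (Polynomial.basisMonomials k) n = X ^ n by
    simp only [coe_basisMonomials, monomial_one_right_eq_X_pow]] at h

open Polynomial in
lemma opB_pow (μ β : k) (n : ℕ) : opB μ β (X ^ n) = (ABseq μ β n).2 := by
  have h := (Polynomial.basisMonomials k).constr_basis k (fun n => (ABseq μ β n).2) n
  rwa [show (Polynomial.basisMonomials k) n = X ^ n by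
    simp only [coe_basisMonomials, monomial_one_right_eq_X_pow]] at h

open Polynomial in
lemma end_ext {f g : Module.End k k[X]} (h : ∀ n : ℕ, f (X ^ n) = g (X ^ n)) : f = g := by
  apply (Polynomial.basisMonomials k).ext
  intro n
  simp only [coe_basisMonomials, monomial_one_right_eq_X_pow]
  exact h n

lemma opAX (μ β : k) : opA μ β * opX + opX * opA μ β = opB μ β := by
  apply end_ext
  intro n
  simp only [LinearMap.add_apply, Module.End.mul_apply, opX, LinearMap.mulLeft_apply, ← pow_succ',
    opA_pow, opB_pow, ABseq]
  ring

lemma opBX (μ β : k) : opB μ β * opX + opX * opB μ β = opA μ β := by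
  apply end_ext
  intro n
  simp only [LinearMap.add_apply, Module.End.mul_apply, opX, LinearMap.mulLeft_apply, ← pow_succ',
    opA_pow, opB_pow, ABseq]
  ring

lemma ring_key {R : Type*} [Ring R] (A B x : R) (h1 : A * x + x * A = B)
    (h2 : B * x + x * B = A) :
    (A * B + B * A - x) * x = x * (A * B + B * A - x) := by
  have e1 : A * x = B - x * A := eq_sub_of_add_eq h1
  have e2 : B * x = A - x * B := eq_sub_of_add_eq h2
  have : (A * B + B * A - x) * x = A * (B * x) + B * (A * x) - x * x := by
    simp only [add_mul, sub_mul, mul_assoc]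
  rw [this, e1, e2]
  have : A * (A - x * B) + B * (B - x * A) - x * x
      = A * A + B * B - (A * x) * B - (B * x) * A - x * x := by
    simp only [mul_sub, mul_assoc]; abel
  rw [this, e1, e2]
  simp only [mul_sub, mul_add, sub_mul, mul_assoc]
  abel

lemma perm_rel {R : Type*} [Ring R] (F : Fin 3 → R) (i j l : Fin 3) (hij : i ≠ j) (hjl : j ≠ l)
    (hil : i ≠ l) (h1 : F i * F l + F l * F i = F j) (h2 : F j * F l + F l * F j = F i)
    (h3 : F i * F j + F j * F i = F l) (a b c : Fin 3) (hab : a ≠ b) (hbc : b ≠ c)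
    (hac : a ≠ c) : F a * F b + F b * F a = F c := by
  have hcase : ∀ m : Fin 3, m = i ∨ m = j ∨ m = l := by
    clear h1 h2 h3
    revert i j l; decide
  have g1 := (add_comm _ _).trans h1
  have g2 := (add_comm _ _).trans h2
  have g3 := (add_comm _ _).trans h3
  rcases hcase a with rfl | rfl | rfl <;> rcases hcase b with rfl | rfl | rfl <;>
    rcases hcase c with rfl | rfl | rfl <;> first | contradiction | assumption

open Polynomial in
lemma opAB [CharZero k] (μ β : k) (hμ : μ * μ = 1) :
    opA μ β * opB μ β + opB μ β * opA μ β = opX := by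
  have h1 := opAX μ β
  have h2 := opBX μ β
  set A := opA μ β with hA
  set B := opB μ β with hB
  have key := ring_key A B opX h1 h2
  suffices h : A * B + B * A - opX = 0 from sub_eq_zero.mp h
  apply end_ext
  intro n
  induction n with
  | zero =>
    have ea : A 1 = C (μ / 2) := by simpa [ABseq] using opA_pow μ β 0
    have eb : B 1 = C (-μ) * X + C β := by simpa [ABseq] using opB_pow μ β 0
    have ea1 : A X = C (-μ) * X + C β - X * C (μ / 2) := by simpa [ABseq] using opA_pow μ β 1
    have hc : ∀ (f : Module.End k k[X]) (c : k), f (C c) = C c * f 1 := by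
      intro f c
      have : (C c : k[X]) = c • 1 := by rw [smul_eq_C_mul, mul_one]
      rw [this, map_smul, smul_eq_C_mul, smul_eq_C_mul, mul_one]
    have hcx : ∀ (f : Module.End k k[X]) (c : k), f (C c * X) = C c * f X := by
      intro f c
      rw [← smul_eq_C_mul, map_smul, smul_eq_C_mul]
    simp only [pow_zero, LinearMap.sub_apply, LinearMap.add_apply, Module.End.mul_apply, ea, eb,
      map_add, hc A, hc B, hcx, ea1, LinearMap.zero_apply, opX, LinearMap.mulLeft_apply]
    have h2 : (C (μ / 2) : k[X]) = C (1 / 2) * C μ := by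
      rw [← C_mul]; congr 1; ring
    have h3 : (C μ * C μ : k[X]) = 1 := by rw [← C_mul, hμ, C_1]
    have h4 : (C (1/2) * 2 : k[X]) = 1 := by
      have : (2 : k[X]) = C 2 := rfl
      rw [this, ← C_mul, ← C_1]; congr 1; norm_num
    rw [h2, C_neg]
    linear_combination X * h3 - C β * C μ * (-h4)
  | succ n ih =>
    have : (X ^ (n + 1) : k[X]) = opX (X ^ n) := by simp [opX, pow_succ']
    rw [this, ← Module.End.mul_apply, key, Module.End.mul_apply, ih]
    simp

open Polynomial in
/-- The operators of the generators. -/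
def opF (i j : Fin 3) (μ β : k) (m : Fin 3) : Module.End k k[X] :=
  if m = i then opA μ β else if m = j then opB μ β else opX

lemma opF_rel [CharZero k] (i j l : Fin 3) (hij : i ≠ j) (hjl : j ≠ l) (hil : i ≠ l)
    (μ β : k) (hμ : μ * μ = 1) (a b c : Fin 3) (hab : a ≠ b) (hbc : b ≠ c) (hac : a ≠ c) :
    opF i j μ β a * opF i j μ β b + opF i j μ β b * opF i j μ β a = opF i j μ β c := by
  have h1 := opAX μ β
  have h2 := opBX μ β
  have h3 := opAB μ β hμ
  have ei : opF i j μ β i = opA μ β := by simp [opF]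
  have ej : opF i j μ β j = opB μ β := by simp [opF, hij.symm]
  have el : opF i j μ β l = opX := by simp [opF, hil.symm, hjl.symm]
  refine perm_rel _ i j l hij hjl hil ?_ ?_ ?_ a b c hab hbc hac
  · rw [ei, ej, el]; exact h1
  · rw [ei, ej, el]; exact h2
  · rw [ei, ej, el]; exact h3

open Polynomial in
/-- The representation of `U(g)` on `k[X]`. -/
def repU [CharZero k] (i j l : Fin 3) (hij : i ≠ j) (hjl : j ≠ l) (hil : i ≠ l)
    (μ β : k) (hμ : μ * μ = 1) : Ucol k →ₐ[k] Module.End k k[X] :=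
  RingQuot.liftAlgHom k ⟨FreeAlgebra.lift k (opF i j μ β), by
    intro x y h
    cases h <;> simp only [map_add, map_mul, FreeAlgebra.lift_ι_apply] <;>
      exact opF_rel i j l hij hjl hil μ β hμ _ _ _ (by decide) (by decide) (by decide)⟩

lemma repU_gen [CharZero k] (i j l : Fin 3) (hij : i ≠ j) (hjl : j ≠ l) (hil : i ≠ l)
    (μ β : k) (hμ : μ * μ = 1) (m : Fin 3) :
    repU i j l hij hjl hil μ β hμ (genC k m) = opF i j μ β m := by
  simp [repU, genC]

open Polynomial in
/-- There is a linear map from the induced module to `k[X]` with `a_l ^ p ↦ X ^ p`. -/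
lemma exists_model [CharZero k] (i j l : Fin 3) (hij : i ≠ j) (hjl : j ≠ l) (hil : i ≠ l)
    (μ β : k) (hμ : μ * μ = 1) :
    ∃ f : NmodC k (genC k i - algebraMap k (Ucol k) (μ / 2))
          (genC k j + μ • genC k l - algebraMap k (Ucol k) β) →ₗ[k] k[X],
      ∀ p : ℕ, f (Submodule.Quotient.mk (genC k l ^ p)) = X ^ p := by
  set ρ := repU i j l hij hjl hil μ β hμ with hρ
  have hi : ρ (genC k i) = opA μ β := by rw [hρ, repU_gen]; simp [opF]
  have hj : ρ (genC k j) = opB μ β := by rw [hρ, repU_gen]; simp [opF, hij.symm]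
  have hl : ρ (genC k l) = opX := by rw [hρ, repU_gen]; simp [opF, hil.symm, hjl.symm]
  have ea : opA μ β 1 = C (μ / 2) := by simpa [ABseq] using opA_pow μ β 0
  have eb : opB μ β 1 = C (-μ) * X + C β := by simpa [ABseq] using opB_pow μ β 0
  let g : Ucol k →ₗ[k] k[X] := (LinearMap.applyₗ (1 : k[X])).comp ρ.toLinearMap
  have hg : ∀ u, g u = ρ u 1 := fun _ => rfl
  let J := JUc k (genC k i - algebraMap k (Ucol k) (μ / 2))
          (genC k j + μ • genC k l - algebraMap k (Ucol k) β)
  have hJ : J.restrictScalars k ≤ LinearMap.ker g := by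
    intro x hx
    rw [Submodule.restrictScalars_mem] at hx
    rw [LinearMap.mem_ker, hg]
    refine Submodule.span_induction (p := fun x _ => ρ x 1 = 0) ?_ ?_ ?_ ?_ hx
    · rintro x (rfl | rfl)
      · rw [map_sub, hi, AlgHom.commutes]
        simp [ea, Algebra.algebraMap_eq_smul_one, smul_eq_C_mul]
      · rw [map_sub, map_add, map_smul, hj, hl, AlgHom.commutes]
        simp [eb, opX, Algebra.algebraMap_eq_smul_one, smul_eq_C_mul]
    · simp
    · intro x y _ _ hx hy; simp [hx, hy]
    · intro a x _ hx; simp [hx]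
  refine ⟨((J.restrictScalars k).liftQ g hJ).comp
    (Submodule.Quotient.restrictScalarsEquiv k J).symm.toLinearMap, fun p => ?_⟩
  have : g (genC k l ^ p) = X ^ p := by
    rw [hg, map_pow, hl]
    induction p with
    | zero => simp
    | succ p ih => rw [pow_succ', Module.End.mul_apply, ih]; simp [opX, pow_succ']
  exact this

/-! ### The homogenization as a module over `H` -/

/-- The elements of `U(g)` by which the generators of `H` act (up to shift). -/
def g4 (k : Type) [Field k] (m : Fin 4) : Ucol k :=
  if h : m.val < 3 then genC k ⟨m.val, h⟩ else 1

lemma g4_castSucc (j : Fin 3) : g4 k j.castSucc = genC k j := by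
  simp [g4]

lemma g4_three : g4 k 3 = 1 := by
  simp [g4]

lemma g4_mul_mem (m : Fin 4) (n : ℕ) (u : Ucol k) (hu : u ∈ CF k n) :
    g4 k m * u ∈ CF k (n + 1) := by
  rw [CF, pow_succ']
  refine Submodule.mul_mem_mul (Submodule.subset_span ?_) hu
  unfold g4
  split_ifs
  · exact Or.inr ⟨_, rfl⟩
  · exact Or.inl rfl

lemma g4_smul_mem (u₁ u₂ : Ucol k) (m : Fin 4) (n : ℕ) (x : NmodC k u₁ u₂)
    (hx : x ∈ NFC k u₁ u₂ n) : g4 k m • x ∈ NFC k u₁ u₂ (n + 1) := by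
  obtain ⟨u, hu, rfl⟩ := hx
  exact ⟨g4 k m * u, g4_mul_mem m n u hu, rfl⟩

/-- The action of a generator of `H` on the homogenization. -/
def opD (u₁ u₂ : Ucol k) (m : Fin 4) : Module.End k (⨁ n : ℕ, ↥(NFC k u₁ u₂ n)) :=
  DirectSum.toModule k ℕ _ fun n =>
    (DirectSum.lof k ℕ (fun n => ↥(NFC k u₁ u₂ n)) (n + 1)).comp
      (LinearMap.restrict (Algebra.lsmul k k (NmodC k u₁ u₂) (g4 k m))
        (fun x hx => g4_smul_mem u₁ u₂ m n x hx))

lemma opD_zero (u₁ u₂ : Ucol k) (m : Fin 4) (x : ⨁ n : ℕ, ↥(NFC k u₁ u₂ n)) :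
    opD u₁ u₂ m x 0 = 0 := by
  induction x using DirectSum.induction_on with
  | zero => simp
  | of n x =>
    rw [← DirectSum.lof_eq_of k, opD, DirectSum.toModule_lof, LinearMap.comp_apply,
      DirectSum.lof_eq_of, DirectSum.of_eq_of_ne _ _ _ (by omega)]
  | add x y hx hy => rw [map_add, DirectSum.add_apply, hx, hy, add_zero]

lemma opD_succ (u₁ u₂ : Ucol k) (m : Fin 4) (x : ⨁ n : ℕ, ↥(NFC k u₁ u₂ n)) (n : ℕ) :
    (opD u₁ u₂ m x (n + 1) : NmodC k u₁ u₂) = g4 k m • (x n : NmodC k u₁ u₂) := by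
  induction x using DirectSum.induction_on with
  | zero => simp
  | of p x =>
    rw [← DirectSum.lof_eq_of k, opD, DirectSum.toModule_lof, LinearMap.comp_apply,
      DirectSum.lof_eq_of, DirectSum.lof_eq_of]
    by_cases h : n = p
    · subst h
      rw [DirectSum.of_eq_same, DirectSum.of_eq_same]
      rfl
    · rw [DirectSum.of_eq_of_ne _ _ _ (by omega), DirectSum.of_eq_of_ne _ _ _ h]
      simp
  | add x y hx hy =>
    rw [map_add, DirectSum.add_apply, DirectSum.add_apply, Submodule.coe_add, hx, hy,
      Submodule.coe_add, smul_add]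

lemma D_ext {u₁ u₂ : Ucol k} {x y : ⨁ n : ℕ, ↥(NFC k u₁ u₂ n)}
    (h : ∀ n, (x n : NmodC k u₁ u₂) = y n) : x = y :=
  DFinsupp.ext fun n => Subtype.ext (h n)

lemma opD_rel (u₁ u₂ : Ucol k) (a b c : Fin 3) (hab : a ≠ b) (hbc : b ≠ c) (hac : a ≠ c) :
    opD u₁ u₂ a.castSucc * opD u₁ u₂ b.castSucc + opD u₁ u₂ b.castSucc * opD u₁ u₂ a.castSucc
      = opD u₁ u₂ c.castSucc * opD u₁ u₂ 3 := by
  refine LinearMap.ext fun x => D_ext fun n => ?_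
  simp only [LinearMap.add_apply, Module.End.mul_apply, DirectSum.add_apply, Submodule.coe_add]
  rcases n with _ | _ | n
  · simp [opD_zero]
  · simp [opD_zero, opD_succ]
  · simp only [opD_succ, g4_castSucc, g4_three, one_smul, ← mul_smul, ← add_smul]
    rw [genC_rel a b c hab hbc hac]

lemma opD_comm (u₁ u₂ : Ucol k) (a : Fin 4) :
    opD u₁ u₂ a * opD u₁ u₂ 3 = opD u₁ u₂ 3 * opD u₁ u₂ a := by
  refine LinearMap.ext fun x => D_ext fun n => ?_
  simp only [Module.End.mul_apply]
  rcases n with _ | _ | n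
  · simp [opD_zero]
  · simp [opD_zero, opD_succ]
  · simp only [opD_succ, g4_three, one_smul]

/-- The representation of `H` on the homogenization. -/
def repH (u₁ u₂ : Ucol k) : Hcol k →ₐ[k] Module.End k (⨁ n : ℕ, ↥(NFC k u₁ u₂ n)) :=
  RingQuot.liftAlgHom k ⟨FreeAlgebra.lift k (opD u₁ u₂), by
    intro x y h
    cases h <;> simp only [map_add, map_mul, FreeAlgebra.lift_ι_apply]
    · exact opD_rel u₁ u₂ 0 1 2 (by decide) (by decide) (by decide)
    · exact opD_rel u₁ u₂ 1 2 0 (by decide) (by decide) (by decide)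
    · exact opD_rel u₁ u₂ 2 0 1 (by decide) (by decide) (by decide)
    · exact opD_comm u₁ u₂ 0
    · exact opD_comm u₁ u₂ 1
    · exact opD_comm u₁ u₂ 2⟩

lemma repH_gen (u₁ u₂ : Ucol k) (m : Fin 4) : repH u₁ u₂ (genHC k m) = opD u₁ u₂ m := by
  simp [repH, genHC]

lemma one_mem_NFC (u₁ u₂ : Ucol k) : (Submodule.Quotient.mk 1 : NmodC k u₁ u₂) ∈ NFC k u₁ u₂ 0 :=
  ⟨1, by rw [CF, pow_zero]; exact Submodule.one_le.mp le_rfl, rfl⟩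

/-- The cyclic generator of the homogenization. -/
def v0 (u₁ u₂ : Ucol k) : ⨁ n : ℕ, ↥(NFC k u₁ u₂ n) :=
  DirectSum.lof k ℕ (fun n => ↥(NFC k u₁ u₂ n)) 0 ⟨Submodule.Quotient.mk 1, one_mem_NFC u₁ u₂⟩

lemma v0_zero (u₁ u₂ : Ucol k) : (v0 u₁ u₂ 0 : NmodC k u₁ u₂) = Submodule.Quotient.mk 1 := by
  rw [v0, DirectSum.lof_eq_of, DirectSum.of_eq_same]

lemma v0_succ (u₁ u₂ : Ucol k) (n : ℕ) : v0 u₁ u₂ (n + 1) = 0 := by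
  rw [v0, DirectSum.lof_eq_of, DirectSum.of_eq_of_ne _ _ _ (by omega)]

/-- Every homogeneous element of the homogenization is in the `H`-span of the generator. -/
lemma repH_surj_aux (u₁ u₂ : Ucol k) (n : ℕ) (u : Ucol k) (hu : u ∈ CF k n) :
    ∃ h : Hcol k, ∀ m, (repH u₁ u₂ h (v0 u₁ u₂) m : NmodC k u₁ u₂) =
      if m = n then Submodule.Quotient.mk u else 0 := by
  induction n generalizing u with
  | zero =>
    rw [CF, pow_zero, Submodule.mem_one] at hu
    obtain ⟨c, rfl⟩ := hu
    refine ⟨algebraMap k _ c, fun m => ?_⟩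
    rw [AlgHom.commutes, Module.algebraMap_end_apply, DirectSum.smul_apply, Submodule.coe_smul]
    rcases m with _ | m
    · rw [v0_zero, if_pos rfl, Algebra.algebraMap_eq_smul_one]
      rfl
    · rw [v0_succ]
      simp
  | succ n ih =>
    rw [CF, pow_succ'] at hu
    induction hu using Submodule.mul_induction_on' with
    | mem_mul_mem a ha b hb =>
      obtain ⟨h, hh⟩ := ih b hb
      have : ∃ g : Hcol k, ∀ x, (repH u₁ u₂ g x 0 = 0) ∧
          ∀ m, (repH u₁ u₂ g x (m + 1) : NmodC k u₁ u₂) = a • (x m : NmodC k u₁ u₂) := by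
        induction ha using Submodule.span_induction with
        | mem a ha =>
          have : ∃ m, g4 k m = a := by
            rcases ha with rfl | ⟨j, rfl⟩
            · exact ⟨3, g4_three⟩
            · exact ⟨j.castSucc, g4_castSucc j⟩
          obtain ⟨m, rfl⟩ := this
          refine ⟨genHC k m, fun x => ?_⟩
          rw [repH_gen]
          exact ⟨opD_zero _ _ _ _, opD_succ _ _ _ _⟩
        | zero => exact ⟨0, fun x => by simp⟩
        | add a b _ _ h1 h2 =>
          obtain ⟨g1, h1⟩ := h1
          obtain ⟨g2, h2⟩ := h2
          refine ⟨g1 + g2, fun x => ⟨?_, fun m => ?_⟩⟩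
          · rw [map_add, LinearMap.add_apply, DirectSum.add_apply, (h1 x).1, (h2 x).1, add_zero]
          · rw [map_add, LinearMap.add_apply, DirectSum.add_apply, Submodule.coe_add, (h1 x).2,
              (h2 x).2, add_smul]
        | smul c a _ h1 =>
          obtain ⟨g1, h1⟩ := h1
          refine ⟨c • g1, fun x => ⟨?_, fun m => ?_⟩⟩
          · rw [map_smul, LinearMap.smul_apply, DirectSum.smul_apply, (h1 x).1, smul_zero]
          · rw [map_smul, LinearMap.smul_apply, DirectSum.smul_apply, Submodule.coe_smul, (h1 x).2,
              smul_assoc]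
      obtain ⟨g, hg⟩ := this
      refine ⟨g * h, fun m => ?_⟩
      rw [map_mul, Module.End.mul_apply]
      rcases m with _ | m
      · rw [(hg _).1]; simp
      · rw [(hg _).2, hh]
        by_cases hm : m = n
        · simp [hm]; rfl
        · simp [hm]
    | add a _ b _ h1 h2 =>
      obtain ⟨g1, h1⟩ := h1
      obtain ⟨g2, h2⟩ := h2
      refine ⟨g1 + g2, fun m => ?_⟩
      rw [map_add, LinearMap.add_apply, DirectSum.add_apply, Submodule.coe_add, h1, h2]
      split_ifs
      · rfl
      · simp

/-- The orbit map is surjective. -/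
lemma repH_surj (u₁ u₂ : Ucol k) (x : ⨁ n : ℕ, ↥(NFC k u₁ u₂ n)) :
    ∃ h : Hcol k, repH u₁ u₂ h (v0 u₁ u₂) = x := by
  induction x using DirectSum.induction_on with
  | zero => exact ⟨0, by simp⟩
  | of n x =>
    obtain ⟨x, u, hu, rfl⟩ := x
    obtain ⟨h, hh⟩ := repH_surj_aux u₁ u₂ n u hu
    refine ⟨h, D_ext fun m => ?_⟩
    rw [hh]
    split_ifs with hm
    · subst hm
      rw [DirectSum.of_eq_same]; rfl
    · rw [DirectSum.of_eq_of_ne _ _ _ hm]; rfl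
  | add x y hx hy =>
    obtain ⟨g1, h1⟩ := hx
    obtain ⟨g2, h2⟩ := hy
    exact ⟨g1 + g2, by rw [map_add, LinearMap.add_apply, h1, h2]⟩

/-- Maps out of cyclic modules. -/
lemma exists_lift {A V : Type} [Ring A] [Algebra k A] [AddCommGroup V] [Module k V]
    (ρ : A →ₐ[k] Module.End k V) (v : V) (w₁ w₂ : A) (h1 : ρ w₁ v = 0) (h2 : ρ w₂ v = 0) :
    ∃ Φ : (A ⧸ Submodule.span A {w₁, w₂}) →ₗ[k] V,
      (∀ h : A, Φ (Submodule.Quotient.mk h) = ρ h v) ∧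
      (∀ (h : A) x, Φ (h • x) = ρ h (Φ x)) := by
  let g : A →ₗ[k] V := (LinearMap.applyₗ v).comp ρ.toLinearMap
  have hg : ∀ u, g u = ρ u v := fun _ => rfl
  have hJ : (Submodule.span A {w₁, w₂}).restrictScalars k ≤ LinearMap.ker g := by
    intro x hx
    rw [Submodule.restrictScalars_mem] at hx
    rw [LinearMap.mem_ker, hg]
    refine Submodule.span_induction (p := fun x _ => ρ x v = 0) ?_ ?_ ?_ ?_ hx
    · rintro x (rfl | rfl)
      · exact h1
      · exact h2
    · simp
    · intro x y _ _ hx hy; simp [hx, hy]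
    · intro a x _ hx; simp [hx]
  let Φ := (((Submodule.span A {w₁, w₂}).restrictScalars k).liftQ g hJ).comp
    (Submodule.Quotient.restrictScalarsEquiv k (Submodule.span A {w₁, w₂})).symm.toLinearMap
  have hΦ : ∀ h : A, Φ (Submodule.Quotient.mk h) = ρ h v := fun _ => rfl
  refine ⟨Φ, hΦ, fun h x => ?_⟩
  obtain ⟨y, rfl⟩ := Submodule.Quotient.mk_surjective _ x
  rw [hΦ, ← Module.End.mul_apply, ← map_mul, ← hΦ]
  rfl

/-- The map from the cyclic module to the homogenization. -/
lemma exists_Phi0 (u₁ u₂ : Ucol k) (w₁ w₂ : Hcol k) (h1 : repH u₁ u₂ w₁ (v0 u₁ u₂) = 0)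
    (h2 : repH u₁ u₂ w₂ (v0 u₁ u₂) = 0) :
    ∃ Φ : LmodC k w₁ w₂ →ₗ[k] ⨁ n : ℕ, ↥(NFC k u₁ u₂ n),
      (∀ h : Hcol k, Φ (Submodule.Quotient.mk h) = repH u₁ u₂ h (v0 u₁ u₂)) ∧
      (∀ (h : Hcol k) x, Φ (h • x) = repH u₁ u₂ h (Φ x)) :=
  exists_lift (repH u₁ u₂) (v0 u₁ u₂) w₁ w₂ h1 h2

lemma A_sub_smul {A : Type} [Ring A] [Algebra k A] (a b : A) (c : k) :
    a - c • b = a + (-c) • b := by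
  rw [sub_eq_add_neg, ← neg_smul]

lemma H_sub_smul (a b : Hcol k) (c : k) : a - c • b = a + (-c) • b := A_sub_smul a b c

lemma U_sub_smul (a b : Ucol k) (c : k) : a - c • b = a + (-c) • b := A_sub_smul a b c

/-! ### Spanning set of the cyclic module -/

lemma span_mem {L : Type} [AddCommGroup L] [Module k L] [Module (Hcol k) L]
    [IsScalarTower k (Hcol k) L] [CharZero k]
    (i j l : Fin 3) (hij : i ≠ j) (hjl : j ≠ l) (hil : i ≠ l)
    (μ β : k) (hμ : μ * μ = 1) (v : L)
    (hv1 : genHC k 3 • v = (2 * μ) • genHC k i.castSucc • v)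
    (hv2 : genHC k j.castSucc • v + μ • genHC k l.castSucc • v = β • genHC k 3 • v)
    (h : Hcol k) :
    h • v ∈ Submodule.span k
      (Set.range fun pq : ℕ × ℕ => (genHC k 3 ^ pq.2 * genHC k l.castSucc ^ pq.1) • v) := by
  set S := Submodule.span k
      (Set.range fun pq : ℕ × ℕ => (genHC k 3 ^ pq.2 * genHC k l.castSucc ^ pq.1) • v) with hS
  set z := genHC k 3 with hz
  set x := genHC k l.castSucc with hx
  set a := genHC k i.castSucc with ha
  set b := genHC k j.castSucc with hb
  have r1 : a * x + x * a = b * z := genHC_rel i l j hil hjl.symm hij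
  have r2 : b * x + x * b = a * z := genHC_rel j l i hjl hil.symm hij.symm
  have cx : x * z = z * x := genHC_comm _
  have ca : a * z = z * a := genHC_comm _
  have cb : b * z = z * b := genHC_comm _
  have hgen : ∀ p q : ℕ, (z ^ q * x ^ p) • v ∈ S := fun p q =>
    Submodule.subset_span ⟨(p, q), rfl⟩
  -- stability from stability on generators
  have stab : ∀ g : Hcol k, (∀ p q : ℕ, g • (z ^ q * x ^ p) • v ∈ S) → ∀ s ∈ S, g • s ∈ S := by
    intro g hg s hs
    rw [hS] at hs
    induction hs using Submodule.span_induction with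
    | mem s hs => obtain ⟨⟨p, q⟩, rfl⟩ := hs; exact hg p q
    | zero => rw [smul_zero]; exact S.zero_mem
    | add s t _ _ h1 h2 => rw [smul_add]; exact S.add_mem h1 h2
    | smul c s _ h1 => rw [smul_comm]; exact S.smul_mem c h1
  have sz : ∀ s ∈ S, z • s ∈ S := by
    refine stab z fun p q => ?_
    rw [smul_smul, ← mul_assoc, ← pow_succ']
    exact hgen _ _
  have szq : ∀ q : ℕ, ∀ s ∈ S, z ^ q • s ∈ S := by
    intro q
    induction q with
    | zero => intro s hs; rwa [pow_zero, one_smul]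
    | succ q ih => intro s hs; rw [pow_succ, mul_smul]; exact ih _ (sz _ hs)
  have sx : ∀ s ∈ S, x • s ∈ S := by
    refine stab x fun p q => ?_
    have : x * (z ^ q * x ^ p) = z ^ q * x ^ (p + 1) := by
      rw [← mul_assoc, (Commute.pow_right (show Commute x z from cx) q).eq, mul_assoc, ← pow_succ']
    rw [smul_smul, this]
    exact hgen _ _
  have hv : v ∈ S := by simpa using hgen 0 0
  have sab : ∀ p : ℕ, a • x ^ p • v ∈ S ∧ b • x ^ p • v ∈ S := by
    intro p
    induction p with
    | zero =>
      rw [pow_zero, one_smul]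
      constructor
      · have : a • v = (μ / 2) • z • v := by
          rw [hv1, smul_smul]
          have : μ / 2 * (2 * μ) = 1 := by
            have h2 : (2 : k) ≠ 0 := two_ne_zero
            field_simp
            linear_combination hμ
          rw [this, one_smul]
        rw [this]
        exact S.smul_mem _ (sz _ hv)
      · rw [eq_sub_of_add_eq hv2]
        exact S.sub_mem (S.smul_mem _ (sz _ hv)) (S.smul_mem _ (sx _ hv))
    | succ p ih =>
      constructor
      · rw [pow_succ', smul_smul, ← mul_assoc, eq_sub_of_add_eq r1, sub_mul, sub_smul, cb,
          mul_assoc, mul_assoc, mul_smul, mul_smul, mul_smul, mul_smul]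
        exact S.sub_mem (sz _ ih.2) (sx _ ih.1)
      · rw [pow_succ', smul_smul, ← mul_assoc, eq_sub_of_add_eq r2, sub_mul, sub_smul, ca,
          mul_assoc, mul_assoc, mul_smul, mul_smul, mul_smul, mul_smul]
        exact S.sub_mem (sz _ ih.1) (sx _ ih.2)
  have sa : ∀ s ∈ S, a • s ∈ S := by
    refine stab a fun p q => ?_
    rw [smul_smul, ← mul_assoc, (Commute.pow_right (show Commute a z from ca) q).eq, mul_assoc,
      mul_smul, mul_smul]
    exact szq _ _ (sab p).1
  have sb : ∀ s ∈ S, b • s ∈ S := by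
    refine stab b fun p q => ?_
    rw [smul_smul, ← mul_assoc, (Commute.pow_right (show Commute b z from cb) q).eq, mul_assoc,
      mul_smul, mul_smul]
    exact szq _ _ (sab p).2
  have sg : ∀ m : Fin 4, ∀ s ∈ S, genHC k m • s ∈ S := by
    intro m
    have hcase : m = 3 ∨ m = i.castSucc ∨ m = j.castSucc ∨ m = l.castSucc := by
      clear * - hij hjl hil
      have key : ∀ i j l : Fin 3, ∀ m : Fin 4, i ≠ j → j ≠ l → i ≠ l →
        m = 3 ∨ m = i.castSucc ∨ m = j.castSucc ∨ m = l.castSucc := by decide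
      exact key i j l m hij hjl hil
    rcases hcase with rfl | rfl | rfl | rfl
    · exact sz
    · exact sa
    · exact sb
    · exact sx
  refine Hcol_induction (P := fun h => ∀ s ∈ S, h • s ∈ S) ?_ sg ?_ ?_ h v hv
  · intro c s hs
    rw [algebraMap_smul]
    exact S.smul_mem c hs
  · intro a b h1 h2 s hs
    rw [mul_smul]
    exact h1 _ (h2 _ hs)
  · intro a b h1 h2 s hs
    rw [add_smul]
    exact S.add_mem (h1 _ hs) (h2 _ hs)

/-- Action of monomials on the generator. -/
lemma repH_mono (u₁ u₂ : Ucol k) (l : Fin 3) (p q m : ℕ) :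
    (repH u₁ u₂ (genHC k 3 ^ q * genHC k l.castSucc ^ p) (v0 u₁ u₂) m : NmodC k u₁ u₂) =
      if m = p + q then Submodule.Quotient.mk (genC k l ^ p) else 0 := by
  induction q generalizing m with
  | zero =>
    rw [pow_zero, one_mul, add_zero]
    induction p generalizing m with
    | zero =>
      rw [pow_zero, map_one, Module.End.one_apply, pow_zero]
      rcases m with _ | m
      · rw [v0_zero, if_pos rfl]
      · rw [v0_succ]; simp
    | succ p ih =>
      rw [pow_succ', map_mul, Module.End.mul_apply, repH_gen]
      rcases m with _ | m
      · rw [opD_zero]; simp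
      · rw [opD_succ, ih, g4_castSucc]
        by_cases hm : m = p
        · rw [if_pos hm, if_pos (by omega), pow_succ']; rfl
        · rw [if_neg hm, if_neg (by omega), smul_zero]
  | succ q ih =>
    rw [pow_succ', mul_assoc, map_mul, Module.End.mul_apply, repH_gen]
    rcases m with _ | m
    · rw [opD_zero, if_neg (by omega)]; rfl
    · rw [opD_succ, ih, g4_three, one_smul]
      by_cases hm : m = p + q
      · rw [if_pos hm, if_pos (by omega)]
      · rw [if_neg hm, if_neg (by omega)]

lemma repH_w1 [CharZero k] (u₂ : Ucol k) (i : Fin 3) (μ : k) (hμ : μ * μ = 1) :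
    repH (genC k i - algebraMap k (Ucol k) (μ / 2)) u₂
      (genHC k 3 - (2 * μ) • genHC k i.castSucc)
      (v0 (genC k i - algebraMap k (Ucol k) (μ / 2)) u₂) = 0 := by
  set u₁ := genC k i - algebraMap k (Ucol k) (μ / 2) with hu
  refine D_ext fun n => ?_
  rw [H_sub_smul, map_add, map_smul, repH_gen, repH_gen, LinearMap.add_apply,
    LinearMap.smul_apply, DirectSum.add_apply, DirectSum.smul_apply, Submodule.coe_add,
    Submodule.coe_smul]
  rcases n with _ | _ | n
  · simp [opD_zero]
  · rw [opD_succ, opD_succ, v0_zero, g4_three, g4_castSucc, one_smul]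
    have h0 : (Submodule.Quotient.mk u₁ : NmodC k u₁ u₂) = 0 := by
      rw [Submodule.Quotient.mk_eq_zero]
      exact Submodule.subset_span (by simp)
    have e : (Submodule.Quotient.mk 1 : NmodC k u₁ u₂)
        + (-(2 * μ)) • genC k i • (Submodule.Quotient.mk 1 : NmodC k u₁ u₂)
        = Submodule.Quotient.mk (1 + (-(2 * μ)) • (genC k i * 1)) := rfl
    have e2 : (1 : Ucol k) + (-(2 * μ)) • (genC k i * 1) = (-(2 * μ)) • u₁ := by
      have : (-(2 * μ)) * (μ / 2) = -1 := by
        have h2 : (2 : k) ≠ 0 := two_ne_zero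
        field_simp
        linear_combination -hμ
      rw [hu, Algebra.algebraMap_eq_smul_one, U_sub_smul, smul_add, smul_smul, mul_neg, this,
        mul_one, neg_neg, one_smul, add_comm]
    rw [e, e2]
    change (-(2 * μ)) • (Submodule.Quotient.mk u₁ : NmodC k u₁ u₂) = 0
    rw [h0]
    exact smul_zero (A := NmodC k u₁ u₂) (-(2 * μ))
  · rw [opD_succ, opD_succ, v0_succ]; simp

lemma repH_w2 (u₁ : Ucol k) (j l : Fin 3) (μ β : k) :
    repH u₁ (genC k j + μ • genC k l - algebraMap k (Ucol k) β)
      (genHC k j.castSucc + μ • genHC k l.castSucc - β • genHC k 3)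
      (v0 u₁ (genC k j + μ • genC k l - algebraMap k (Ucol k) β)) = 0 := by
  set u₂ := genC k j + μ • genC k l - algebraMap k (Ucol k) β with hu
  refine D_ext fun n => ?_
  rw [H_sub_smul, map_add, map_smul, map_add, map_smul, repH_gen, repH_gen,
    repH_gen, LinearMap.add_apply,
    LinearMap.smul_apply, LinearMap.add_apply, LinearMap.smul_apply, DirectSum.add_apply,
    DirectSum.smul_apply, DirectSum.add_apply, DirectSum.smul_apply, Submodule.coe_add,
    Submodule.coe_smul, Submodule.coe_add, Submodule.coe_smul]
  rcases n with _ | _ | n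
  · simp [opD_zero]
  · rw [opD_succ, opD_succ, opD_succ, v0_zero, g4_three, g4_castSucc, g4_castSucc, one_smul]
    have h0 : (Submodule.Quotient.mk u₂ : NmodC k u₁ u₂) = 0 := by
      rw [Submodule.Quotient.mk_eq_zero]
      exact Submodule.subset_span (by simp)
    have e : genC k j • (Submodule.Quotient.mk 1 : NmodC k u₁ u₂)
        + μ • genC k l • (Submodule.Quotient.mk 1 : NmodC k u₁ u₂)
        + (-β) • (Submodule.Quotient.mk 1 : NmodC k u₁ u₂)
        = Submodule.Quotient.mk (genC k j * 1 + μ • (genC k l * 1) + (-β) • 1) := rfl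
    rw [e, mul_one, mul_one, ← U_sub_smul, ← Algebra.algebraMap_eq_smul_one, ← hu, h0]
    rfl
  · rw [opD_succ, opD_succ, opD_succ, v0_succ]; simp

/-! ### The main structural statement -/

/-- `Φ` is the orbit-map isomorphism. -/
lemma exists_Phi [CharZero k] (i j l : Fin 3) (hij : i ≠ j) (hjl : j ≠ l) (hil : i ≠ l)
    (μ β : k) (hμ : μ * μ = 1) (u₁ u₂ : Ucol k) (w₁ w₂ : Hcol k)
    (hu₁ : u₁ = genC k i - algebraMap k (Ucol k) (μ / 2))
    (hu₂ : u₂ = genC k j + μ • genC k l - algebraMap k (Ucol k) β)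
    (hw₁ : w₁ = genHC k 3 - (2 * μ) • genHC k i.castSucc)
    (hw₂ : w₂ = genHC k j.castSucc + μ • genHC k l.castSucc - β • genHC k 3) :
    (∃ Φ : LmodC k w₁ w₂ ≃ₗ[k] ⨁ n : ℕ, ↥(NFC k u₁ u₂ n),
      (∀ h : Hcol k, Φ (Submodule.Quotient.mk h) = repH u₁ u₂ h (v0 u₁ u₂)) ∧
      (∀ (h : Hcol k) x, Φ (h • x) = repH u₁ u₂ h (Φ x))) ∧
    (∀ n, Module.finrank k (NFC k u₁ u₂ n) = n + 1) ∧
    (Submodule.Quotient.mk 1 : NmodC k u₁ u₂) ≠ 0 := by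
  have r1 : repH u₁ u₂ w₁ (v0 u₁ u₂) = 0 := by
    subst hu₁ hw₁; exact repH_w1 _ i μ hμ
  have r2 : repH u₁ u₂ w₂ (v0 u₁ u₂) = 0 := by
    subst hu₂ hw₂; exact repH_w2 _ j l μ β
  obtain ⟨Φ, hΦ1, hΦ2⟩ := exists_Phi0 u₁ u₂ w₁ w₂ r1 r2
  have hm : ∃ f : NmodC k u₁ u₂ →ₗ[k] Polynomial k,
      ∀ p : ℕ, f (Submodule.Quotient.mk (genC k l ^ p)) = Polynomial.X ^ p := by
    subst hu₁ hu₂; exact exists_model i j l hij hjl hil μ β hμ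
  obtain ⟨f, hf⟩ := hm
  -- the spanning set
  let e : ℕ × ℕ → LmodC k w₁ w₂ := fun pq =>
    Submodule.Quotient.mk (genHC k 3 ^ pq.2 * genHC k l.castSucc ^ pq.1)
  have hespan : ∀ x, x ∈ Submodule.span k (Set.range e) := by
    intro x
    obtain ⟨h, rfl⟩ := Submodule.Quotient.mk_surjective _ x
    have z1 : (Submodule.Quotient.mk (genHC k 3 - (2 * μ) • genHC k i.castSucc) :
        LmodC k w₁ w₂) = 0 := by
      rw [Submodule.Quotient.mk_eq_zero, ← hw₁]; exact Submodule.subset_span (by simp)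
    have z2 : (Submodule.Quotient.mk
        (genHC k j.castSucc + μ • genHC k l.castSucc - β • genHC k 3) : LmodC k w₁ w₂) = 0 := by
      rw [Submodule.Quotient.mk_eq_zero, ← hw₂]; exact Submodule.subset_span (by simp)
    have key : ∀ g : Hcol k, g • (Submodule.Quotient.mk 1 : LmodC k w₁ w₂)
        = Submodule.Quotient.mk g := by
      intro g
      rw [← Submodule.Quotient.mk_smul, smul_eq_mul, mul_one]
    have := span_mem i j l hij hjl hil μ β hμ (Submodule.Quotient.mk 1 : LmodC k w₁ w₂)
      (by rw [key, key, ← sub_eq_zero]; exact z1)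
      (by rw [key, key, key, ← sub_eq_zero]; exact z2) h
    rw [key] at this
    simp only [key] at this
    exact this
  have hΦe : ∀ p q m : ℕ, (Φ (e (p, q)) m : NmodC k u₁ u₂) =
      if m = p + q then Submodule.Quotient.mk (genC k l ^ p) else 0 := by
    intro p q m
    rw [hΦ1, repH_mono]
  -- a left inverse
  let ψ : ∀ n : ℕ, NFC k u₁ u₂ n →ₗ[k] LmodC k w₁ w₂ := fun n =>
    (((Polynomial.basisMonomials k).constr k fun p => e (p, n - p)).comp f).comp
      (NFC k u₁ u₂ n).subtype
  let Ψ : (⨁ n : ℕ, ↥(NFC k u₁ u₂ n)) →ₗ[k] LmodC k w₁ w₂ := DirectSum.toModule k ℕ _ ψ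
  have hΨe : ∀ p q, Ψ (Φ (e (p, q))) = e (p, q) := by
    intro p q
    have hlof : Φ (e (p, q)) =
        DirectSum.lof k ℕ (fun n => ↥(NFC k u₁ u₂ n)) (p + q) (Φ (e (p, q)) (p + q)) := by
      refine D_ext fun m => ?_
      rw [DirectSum.lof_eq_of]
      by_cases h : m = p + q
      · subst h; rw [DirectSum.of_eq_same]
      · rw [DirectSum.of_eq_of_ne _ _ _ h, hΦe, if_neg h]; rfl
    rw [hlof, DirectSum.toModule_lof]
    change ((Polynomial.basisMonomials k).constr k fun r => e (r, p + q - r))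
      (f (Φ (e (p, q)) (p + q) : NmodC k u₁ u₂)) = _
    rw [hΦe, if_pos rfl, hf]
    have h := (Polynomial.basisMonomials k).constr_basis k (fun r => e (r, p + q - r)) p
    rw [show (Polynomial.basisMonomials k) p = Polynomial.X ^ p by
      simp only [Polynomial.coe_basisMonomials, Polynomial.monomial_one_right_eq_X_pow]] at h
    rw [h, Nat.add_sub_cancel_left]
  have hΨ : ∀ x, Ψ (Φ x) = x := by
    intro x
    have := hespan x
    induction this using Submodule.span_induction with
    | mem x hx => obtain ⟨⟨p, q⟩, rfl⟩ := hx; exact hΨe p q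
    | zero => rw [map_zero, map_zero]
    | add x y _ _ h1 h2 => rw [map_add, map_add, h1, h2]
    | smul c x _ h1 => rw [map_smul, map_smul, h1]
  have hsurj : Function.Surjective Φ := by
    intro y
    obtain ⟨h, hh⟩ := repH_surj u₁ u₂ y
    exact ⟨Submodule.Quotient.mk h, by rw [hΦ1, hh]⟩
  refine ⟨⟨LinearEquiv.ofBijective Φ ⟨Function.LeftInverse.injective hΨ, hsurj⟩, hΦ1, hΦ2⟩,
    fun n => ?_, ?_⟩
  · -- dimension
    let b : Fin (n + 1) → NmodC k u₁ u₂ := fun p => Submodule.Quotient.mk (genC k l ^ (p : ℕ))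
    have hb : LinearIndependent k b := by
      apply LinearIndependent.of_comp f
      have : f ∘ b = (Polynomial.basisMonomials k) ∘ (fun p : Fin (n + 1) => (p : ℕ)) := by
        funext p
        simp only [b, Function.comp_apply, hf, Polynomial.coe_basisMonomials,
          Polynomial.monomial_one_right_eq_X_pow]
      rw [this]
      exact (Polynomial.basisMonomials k).linearIndependent.comp _ Fin.val_injective
    have hspan : NFC k u₁ u₂ n = Submodule.span k (Set.range b) := by
      apply le_antisymm
      · intro x hx
        obtain ⟨y, hy⟩ := hsurj (DirectSum.lof k ℕ (fun n => ↥(NFC k u₁ u₂ n)) n ⟨x, hx⟩)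
        have hyx : (Φ y n : NmodC k u₁ u₂) = x := by
          rw [hy, DirectSum.lof_eq_of, DirectSum.of_eq_same]
        rw [← hyx]
        clear hyx hy
        have := hespan y
        induction this using Submodule.span_induction with
        | mem x hx =>
          obtain ⟨⟨p, q⟩, rfl⟩ := hx
          rw [hΦe]
          split_ifs with h
          · exact Submodule.subset_span ⟨⟨p, by omega⟩, rfl⟩
          · exact Submodule.zero_mem _
        | zero => rw [map_zero]; exact Submodule.zero_mem _
        | add x y _ _ h1 h2 =>
          rw [map_add, DirectSum.add_apply, Submodule.coe_add]; exact Submodule.add_mem _ h1 h2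
        | smul c x _ h1 =>
          rw [map_smul, DirectSum.smul_apply, Submodule.coe_smul]; exact Submodule.smul_mem _ c h1
      · rw [Submodule.span_le]
        rintro _ ⟨p, rfl⟩
        have := hΦe p (n - p) n
        rw [if_pos (by omega)] at this
        change Submodule.Quotient.mk (genC k l ^ (p : ℕ)) ∈ NFC k u₁ u₂ n
        rw [← this]
        exact (Φ (e (p, n - p)) n).2
    rw [hspan, finrank_span_eq_card hb, Fintype.card_fin]
  · intro h0
    have := hf 0
    rw [pow_zero, h0, map_zero, pow_zero] at this
    exact zero_ne_one this

/-! ### Consequences -/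

lemma lineModule_of_Phi (u₁ u₂ : Ucol k) (w₁ w₂ : Hcol k)
    (Φ : LmodC k w₁ w₂ ≃ₗ[k] ⨁ n : ℕ, ↥(NFC k u₁ u₂ n))
    (hΦ1 : ∀ h : Hcol k, Φ (Submodule.Quotient.mk h) = repH u₁ u₂ h (v0 u₁ u₂))
    (hΦ2 : ∀ (h : Hcol k) x, Φ (h • x) = repH u₁ u₂ h (Φ x))
    (hd : ∀ n, Module.finrank k (NFC k u₁ u₂ n) = n + 1) :
    IsLineModule k (Hcol k) (LmodC k w₁ w₂) (Set.range (genHC k)) := by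
  let lf : ∀ n, NFC k u₁ u₂ n →ₗ[k] ⨁ n : ℕ, ↥(NFC k u₁ u₂ n) := fun n =>
    DirectSum.lof k ℕ (fun n => ↥(NFC k u₁ u₂ n)) n
  have hlf : ∀ n x, Φ.symm.toLinearMap.comp (lf n) x = Φ.symm (lf n x) := fun _ _ => rfl
  refine ⟨fun n => LinearMap.range (Φ.symm.toLinearMap.comp (lf n)), ?_, ?_, ?_, ?_, ?_⟩
  · rw [iSupIndep_def]
    intro n
    rw [Submodule.disjoint_def]
    intro x hx hx'
    have h2 : Φ x n = 0 := by
      have hle : (⨆ m, ⨆ (_ : m ≠ n), LinearMap.range (Φ.symm.toLinearMap.comp (lf m))) ≤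
          LinearMap.ker ((DirectSum.component k ℕ (fun n => ↥(NFC k u₁ u₂ n)) n).comp
            Φ.toLinearMap) := by
        refine iSup_le fun m => iSup_le fun hmn => ?_
        rintro _ ⟨y, rfl⟩
        rw [LinearMap.mem_ker, hlf]
        change (Φ (Φ.symm (lf m y))) n = 0
        rw [LinearEquiv.apply_symm_apply]
        change (DirectSum.lof k ℕ (fun n => ↥(NFC k u₁ u₂ n)) m y) n = 0
        rw [DirectSum.lof_eq_of, DirectSum.of_eq_of_ne _ _ _ hmn.symm]
      exact hle hx'
    obtain ⟨y, rfl⟩ := hx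
    rw [hlf] at h2 ⊢
    rw [LinearEquiv.apply_symm_apply] at h2
    change (DirectSum.lof k ℕ (fun n => ↥(NFC k u₁ u₂ n)) n y) n = 0 at h2
    rw [DirectSum.lof_eq_of, DirectSum.of_eq_same] at h2
    rw [h2, (lf n).map_zero]
    exact Φ.symm.map_zero
  · rw [eq_top_iff]
    intro x _
    rw [← Φ.symm_apply_apply x]
    generalize Φ x = y
    induction y using DirectSum.induction_on with
    | zero => rw [Φ.symm.map_zero]; exact Submodule.zero_mem _
    | of n y =>
      exact Submodule.mem_iSup_of_mem n ⟨y, rfl⟩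
    | add x y hx hy => rw [map_add]; exact Submodule.add_mem _ hx hy
  · intro n
    rw [← hd n]
    refine LinearMap.finrank_range_of_inj ?_
    intro a b hab
    rw [hlf, hlf] at hab
    exact DirectSum.of_injective (β := fun n => ↥(NFC k u₁ u₂ n)) n (Φ.symm.injective hab)
  · rintro _ ⟨m, rfl⟩ n _ ⟨y, rfl⟩
    refine ⟨⟨g4 k m • (y : NmodC k u₁ u₂), g4_smul_mem _ _ _ _ _ y.2⟩, ?_⟩
    rw [hlf, hlf]
    apply Φ.injective
    rw [LinearEquiv.apply_symm_apply, hΦ2, LinearEquiv.apply_symm_apply, repH_gen, opD]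
    change _ = DirectSum.toModule k ℕ _ _ (DirectSum.lof k ℕ (fun n => ↥(NFC k u₁ u₂ n)) n y)
    rw [DirectSum.toModule_lof]
    rfl
  · refine ⟨Submodule.Quotient.mk 1, ⟨⟨Submodule.Quotient.mk 1, one_mem_NFC u₁ u₂⟩, ?_⟩, ?_⟩
    · rw [hlf, LinearEquiv.symm_apply_eq, hΦ1, map_one]
      rfl
    · rw [eq_top_iff]
      intro x _
      obtain ⟨h, rfl⟩ := Submodule.Quotient.mk_surjective _ x
      rw [Submodule.mem_span_singleton]
      exact ⟨h, by rw [← Submodule.Quotient.mk_smul, smul_eq_mul, mul_one]⟩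

lemma torsion_of_Phi (u₁ u₂ : Ucol k) (w₁ w₂ : Hcol k)
    (Φ : LmodC k w₁ w₂ ≃ₗ[k] ⨁ n : ℕ, ↥(NFC k u₁ u₂ n))
    (hΦ2 : ∀ (h : Hcol k) x, Φ (h • x) = repH u₁ u₂ h (Φ x)) (x : LmodC k w₁ w₂)
    (hx : genHC k 3 • x = 0) : x = 0 := by
  apply Φ.injective
  rw [map_zero]
  refine D_ext fun n => ?_
  have := congrArg (fun y => (Φ y (n + 1) : NmodC k u₁ u₂)) hx
  simp only at this
  rw [hΦ2, repH_gen, opD_succ, g4_three, one_smul, map_zero] at this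
  exact this

lemma homIso_of_Phi (u₁ u₂ : Ucol k) (w₁ w₂ : Hcol k)
    (Φ : LmodC k w₁ w₂ ≃ₗ[k] ⨁ n : ℕ, ↥(NFC k u₁ u₂ n))
    (hΦ1 : ∀ h : Hcol k, Φ (Submodule.Quotient.mk h) = repH u₁ u₂ h (v0 u₁ u₂))
    (hΦ2 : ∀ (h : Hcol k) x, Φ (h • x) = repH u₁ u₂ h (Φ x)) :
    IsHomogenizationIsoC k u₁ u₂ w₁ w₂ Φ := by
  refine ⟨⟨?_, fun n => ?_⟩, fun x => ⟨?_, fun n => ?_⟩, fun j x => ⟨?_, fun n => ?_⟩⟩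
  · rw [hΦ1, map_one, Module.End.one_apply, v0_zero]
  · rw [hΦ1, map_one, Module.End.one_apply, v0_succ]
  · rw [hΦ2, repH_gen, opD_zero]
  · rw [hΦ2, repH_gen, opD_succ, g4_three, one_smul]
  · rw [hΦ2, repH_gen, opD_zero]
  · rw [hΦ2, repH_gen, opD_succ, g4_castSucc]

/-- Degree one elements act as degree one operators. -/
lemma repH_deg1 (u₁ u₂ : Ucol k) (w : Hcol k) (hw : w ∈ Submodule.span k (Set.range (genHC k))) :
    ∃ u : Ucol k, ∀ x, repH u₁ u₂ w x 0 = 0 ∧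
      ∀ m, (repH u₁ u₂ w x (m + 1) : NmodC k u₁ u₂) = u • (x m : NmodC k u₁ u₂) := by
  induction hw using Submodule.span_induction with
  | mem w hw =>
    obtain ⟨m, rfl⟩ := hw
    refine ⟨g4 k m, fun x => ?_⟩
    rw [repH_gen]
    exact ⟨opD_zero _ _ _ _, opD_succ _ _ _ _⟩
  | zero => exact ⟨0, fun x => by simp⟩
  | add a b _ _ h1 h2 =>
    obtain ⟨g1, h1⟩ := h1
    obtain ⟨g2, h2⟩ := h2
    refine ⟨g1 + g2, fun x => ⟨?_, fun m => ?_⟩⟩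
    · rw [map_add, LinearMap.add_apply, DirectSum.add_apply, (h1 x).1, (h2 x).1, add_zero]
    · rw [map_add, LinearMap.add_apply, DirectSum.add_apply, Submodule.coe_add, (h1 x).2,
        (h2 x).2, add_smul]
  | smul c a _ h1 =>
    obtain ⟨g1, h1⟩ := h1
    refine ⟨c • g1, fun x => ⟨?_, fun m => ?_⟩⟩
    · rw [map_smul, LinearMap.smul_apply, DirectSum.smul_apply, (h1 x).1, smul_zero]
    · rw [map_smul, LinearMap.smul_apply, DirectSum.smul_apply, Submodule.coe_smul, (h1 x).2,
        smul_assoc]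

/-- An element annihilating a generator in degree one annihilates the canonical generator. -/
lemma mem_of_ann (u₁ u₂ : Ucol k) (w₁ w₂ : Hcol k)
    (Φ : LmodC k w₁ w₂ ≃ₗ[k] ⨁ n : ℕ, ↥(NFC k u₁ u₂ n))
    (hΦ1 : ∀ h : Hcol k, Φ (Submodule.Quotient.mk h) = repH u₁ u₂ h (v0 u₁ u₂))
    (hΦ2 : ∀ (h : Hcol k) x, Φ (h • x) = repH u₁ u₂ h (Φ x))
    (hne : (Submodule.Quotient.mk 1 : NmodC k u₁ u₂) ≠ 0)
    (y : LmodC k w₁ w₂) (h : Hcol k) (hy : h • y = Submodule.Quotient.mk 1)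
    (w : Hcol k) (hw : w ∈ Submodule.span k (Set.range (genHC k))) (hwy : w • y = 0) :
    w ∈ JHc k w₁ w₂ := by
  obtain ⟨u, hu⟩ := repH_deg1 u₁ u₂ w hw
  obtain ⟨c, hc⟩ : ∃ c : k, (Φ y 0 : NmodC k u₁ u₂) = c • Submodule.Quotient.mk 1 := by
    obtain ⟨t, ht, ht'⟩ := (Φ y 0).2
    rw [← ht']
    rw [CF, pow_zero] at ht
    obtain ⟨c, rfl⟩ := Submodule.mem_one.mp ht
    exact ⟨c, by rw [Algebra.algebraMap_eq_smul_one]; rfl⟩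
  have hc0 : c ≠ 0 := by
    rintro rfl
    replace hc := hc.trans (zero_smul k (Submodule.Quotient.mk 1 : NmodC k u₁ u₂))
    have hzero : ∀ (h : Hcol k) x, x 0 = 0 → repH u₁ u₂ h x 0 = 0 := by
      intro h
      refine Hcol_induction (P := fun h => ∀ x, x 0 = 0 → repH u₁ u₂ h x 0 = 0) ?_ ?_ ?_ ?_ h
      · intro c x hx
        rw [AlgHom.commutes, Module.algebraMap_end_apply, DirectSum.smul_apply, hx, smul_zero]
      · intro m x _
        rw [repH_gen, opD_zero]
      · intro a b h1 h2 x hx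
        rw [map_mul, Module.End.mul_apply]
        exact h1 _ (h2 _ hx)
      · intro a b h1 h2 x hx
        rw [map_add, LinearMap.add_apply, DirectSum.add_apply, h1 x hx, h2 x hx, add_zero]
    have h1 := hzero h (Φ y) (Subtype.ext hc)
    rw [← hΦ2, hy, hΦ1, map_one, Module.End.one_apply] at h1
    apply hne
    rw [← v0_zero, h1]
    rfl
  have hu0 : u • (Submodule.Quotient.mk 1 : NmodC k u₁ u₂) = 0 := by
    have h1 := (hu (Φ y)).2 0
    rw [← hΦ2, hwy, map_zero, hc, smul_comm] at h1
    exact (smul_eq_zero.mp h1.symm).resolve_left hc0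
  rw [← Submodule.Quotient.mk_eq_zero]
  apply Φ.injective
  rw [hΦ1, map_zero]
  refine D_ext fun n => ?_
  rcases n with _ | _ | n
  · rw [(hu _).1]; rfl
  · rw [(hu _).2, v0_zero, hu0]; rfl
  · rw [(hu _).2, v0_succ]; exact smul_zero _

lemma ann_of_iso {w₁ w₂ w₁' w₂' : Hcol k} (f : LmodC k w₁ w₂ ≃ₗ[Hcol k] LmodC k w₁' w₂')
    (w : Hcol k) (hw : w ∈ JHc k w₁ w₂) : w • f (Submodule.Quotient.mk 1) = 0 := by
  rw [← map_smul, ← Submodule.Quotient.mk_smul, smul_eq_mul, mul_one,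
    (Submodule.Quotient.mk_eq_zero _).mpr hw, map_zero]

lemma gen_of_iso {w₁ w₂ w₁' w₂' : Hcol k} (f : LmodC k w₁ w₂ ≃ₗ[Hcol k] LmodC k w₁' w₂') :
    ∃ h : Hcol k, h • f (Submodule.Quotient.mk 1) = Submodule.Quotient.mk 1 := by
  obtain ⟨h, hh⟩ := Submodule.Quotient.mk_surjective _ (f.symm (Submodule.Quotient.mk 1))
  refine ⟨h, ?_⟩
  rw [← map_smul, ← Submodule.Quotient.mk_smul, smul_eq_mul, mul_one, hh,
    LinearEquiv.apply_symm_apply]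

lemma w1_mem (i : Fin 3) (μ : k) : genHC k 3 - (2 * μ) • genHC k i.castSucc ∈
    Submodule.span k (Set.range (genHC k)) := by
  rw [H_sub_smul]
  exact Submodule.add_mem _ (Submodule.subset_span ⟨_, rfl⟩)
    (Submodule.smul_mem _ _ (Submodule.subset_span ⟨_, rfl⟩))

lemma w2_mem (j l : Fin 3) (μ β : k) :
    genHC k j.castSucc + μ • genHC k l.castSucc - β • genHC k 3 ∈
    Submodule.span k (Set.range (genHC k)) := by
  rw [H_sub_smul]
  exact Submodule.add_mem _ (Submodule.add_mem _ (Submodule.subset_span ⟨_, rfl⟩)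
    (Submodule.smul_mem _ _ (Submodule.subset_span ⟨_, rfl⟩)))
    (Submodule.smul_mem _ _ (Submodule.subset_span ⟨_, rfl⟩))

/-- One inclusion of the left ideals from an isomorphism. -/
lemma JHc_le_of_iso [CharZero k] (i' j' l' : Fin 3) (hij : i' ≠ j') (hjl : j' ≠ l')
    (hil : i' ≠ l') (μ' β' : k) (hμ : μ' * μ' = 1) (w₁ w₂ : Hcol k)
    (h1 : w₁ ∈ Submodule.span k (Set.range (genHC k)))
    (h2 : w₂ ∈ Submodule.span k (Set.range (genHC k)))
    (f : LmodC k w₁ w₂ ≃ₗ[Hcol k] LmodC k (genHC k 3 - (2 * μ') • genHC k i'.castSucc)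
      (genHC k j'.castSucc + μ' • genHC k l'.castSucc - β' • genHC k 3)) :
    JHc k w₁ w₂ ≤ JHc k (genHC k 3 - (2 * μ') • genHC k i'.castSucc)
      (genHC k j'.castSucc + μ' • genHC k l'.castSucc - β' • genHC k 3) := by
  obtain ⟨⟨Φ, hΦ1, hΦ2⟩, -, hne⟩ := exists_Phi i' j' l' hij hjl hil μ' β' hμ _ _ _ _
    rfl rfl rfl rfl
  obtain ⟨h, hh⟩ := gen_of_iso f
  refine Submodule.span_le.mpr ?_
  rintro w (rfl | rfl)
  · exact mem_of_ann _ _ _ _ Φ hΦ1 hΦ2 hne _ h hh _ h1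
      (ann_of_iso f _ (Submodule.subset_span (by simp)))
  · exact mem_of_ann _ _ _ _ Φ hΦ1 hΦ2 hne _ h hh _ h2
      (ann_of_iso f _ (Submodule.subset_span (by simp)))

end Helpers

theorem stmt14 (k : Type) [Field k] [IsAlgClosed k] [CharZero k]
    (i j l : Fin 3) (hij : i ≠ j) (hjl : j ≠ l) (hil : i ≠ l)
    (μ : k) (hμ : μ = 1 ∨ μ = -1)
    -- φ ∈ 𝔥*, 𝔥 = k·a_i ⊕ k·(a_j + μa_l), with φ(a_i) = μ/2 and φ(a_j + μa_l) = β
    (β : k) :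
    -- ℋ(U(g) ⊗_{U(𝔥)} k_φ) is a line module over H …
    IsLineModule k (Hcol k)
      (LmodC k (genHC k 3 - (2 * μ) • genHC k i.castSucc)
        (genHC k j.castSucc + μ • genHC k l.castSucc - β • genHC k 3))
      (Set.range (genHC k)) ∧
    -- … on which a₄ acts without torsion …
    (∀ x : LmodC k (genHC k 3 - (2 * μ) • genHC k i.castSucc)
        (genHC k j.castSucc + μ • genHC k l.castSucc - β • genHC k 3),
      genHC k 3 • x = 0 → x = 0) ∧
    -- … and ℋ(U(g) ⊗_{U(𝔥)} k_φ) ≅ H/(H(a₄ − 2μa_i) + H(a_j + μa_l − φ(a_j + μa_l)a₄))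
    -- as graded left H-modules
    (∃ Φ : LmodC k (genHC k 3 - (2 * μ) • genHC k i.castSucc)
        (genHC k j.castSucc + μ • genHC k l.castSucc - β • genHC k 3) ≃ₗ[k]
        ⨁ n : ℕ, ↥(NFC k (genC k i - algebraMap k (Ucol k) (μ / 2))
          (genC k j + μ • genC k l - algebraMap k (Ucol k) β) n),
      IsHomogenizationIsoC k (genC k i - algebraMap k (Ucol k) (μ / 2))
        (genC k j + μ • genC k l - algebraMap k (Ucol k) β)
        (genHC k 3 - (2 * μ) • genHC k i.castSucc)
        (genHC k j.castSucc + μ • genHC k l.castSucc - β • genHC k 3) Φ) ∧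
    -- moreover distinct pairs (𝔥, φ) of this form — equivalently, distinct left ideals —
    -- yield non-isomorphic line modules
    (∀ (i' j' l' : Fin 3), i' ≠ j' → j' ≠ l' → i' ≠ l' →
      ∀ μ' : k, (μ' = 1 ∨ μ' = -1) → ∀ β' : k,
      JHc k (genHC k 3 - (2 * μ) • genHC k i.castSucc)
          (genHC k j.castSucc + μ • genHC k l.castSucc - β • genHC k 3) ≠
        JHc k (genHC k 3 - (2 * μ') • genHC k i'.castSucc)
          (genHC k j'.castSucc + μ' • genHC k l'.castSucc - β' • genHC k 3) →
      IsEmpty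
        (LmodC k (genHC k 3 - (2 * μ) • genHC k i.castSucc)
            (genHC k j.castSucc + μ • genHC k l.castSucc - β • genHC k 3) ≃ₗ[Hcol k]
          LmodC k (genHC k 3 - (2 * μ') • genHC k i'.castSucc)
            (genHC k j'.castSucc + μ' • genHC k l'.castSucc - β' • genHC k 3))) := by
  have hμ2 : μ * μ = 1 := by rcases hμ with rfl | rfl <;> ring
  obtain ⟨⟨Φ, hΦ1, hΦ2⟩, hd, -⟩ := exists_Phi i j l hij hjl hil μ β hμ2 _ _ _ _
    rfl rfl rfl rfl
  refine ⟨lineModule_of_Phi _ _ _ _ Φ hΦ1 hΦ2 hd, torsion_of_Phi _ _ _ _ Φ hΦ2,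
    ⟨Φ, homIso_of_Phi _ _ _ _ Φ hΦ1 hΦ2⟩, ?_⟩
  intro i' j' l' hij' hjl' hil' μ' hμ' β' hJ
  have hμ2' : μ' * μ' = 1 := by rcases hμ' with rfl | rfl <;> ring
  refine ⟨fun f => hJ (le_antisymm ?_ ?_)⟩
  · exact JHc_le_of_iso i' j' l' hij' hjl' hil' μ' β' hμ2' _ _ (w1_mem _ _) (w2_mem _ _ _ _) f
  · exact JHc_le_of_iso i j l hij hjl hil μ β hμ2 _ _ (w1_mem _ _) (w2_mem _ _ _ _) f.symm
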